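/- (Parallel Repetition Criterion) Let c ∈ (0,1] be a constant and ρ : ℕ → ℝ a function with exp(−n) ≤ ρ(n) ≤ 1 for all n. Suppose there exists N0 such that for all n ≥ N0 and all sets E1, E2, E3 ⊆ F_2^n with P(E1×E2×E3) ≥ ρ(n), one has (1/n) Σ_{i=1}^{n} val^{(i)}(G | E1×E2×E3) ≤ 1 − c. Then there exist a constant c' > 0 and N ∈ ℕ such that for all n ≥ N, the value of the n-fold GHZ game satisfies val(G^n) ≤ ρ(n)^{c'}. -/

import Mathlib

/-- Vectors of length `n` over `F_2`. -/
abbrev Vec (n : ℕ) := Fin n → ZMod 2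

/-- Boolean OR of three bits: `0` iff all three bits are `0`. -/
def or3 (u v w : ZMod 2) : ZMod 2 := if u = 0 ∧ v = 0 ∧ w = 0 then 0 else 1

/-- The players win coordinate `i` on query `(x, y, x+y)` with strategy `f1, f2, f3`. -/
def winCoord {n : ℕ} (f1 f2 f3 : Vec n → Vec n) (x y : Vec n) (i : Fin n) : Prop :=
  f1 x i + f2 y i + f3 (x + y) i = or3 (x i) (y i) ((x + y) i)

instance {n : ℕ} (f1 f2 f3 : Vec n → Vec n) (x y : Vec n) (i : Fin n) :
    Decidable (winCoord f1 f2 f3 x y i) :=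
  inferInstanceAs (Decidable (_ = _))

/-- The event `E1 × E2 × E3`, viewed as a set of pairs `(x, y)` (with `z = x + y`). -/
def condSet {n : ℕ} (E1 E2 E3 : Set (Vec n)) : Set (Vec n × Vec n) :=
  {p | p.1 ∈ E1 ∧ p.2 ∈ E2 ∧ p.1 + p.2 ∈ E3}

/-- The probability of `E1 × E2 × E3` under the `n`-fold GHZ query distribution. -/
noncomputable def probE {n : ℕ} (E1 E2 E3 : Set (Vec n)) : ℝ :=
  (Nat.card (condSet E1 E2 E3) : ℝ) / (2 : ℝ) ^ (2 * n)

/-- `val^{(i)}(G | E)`: the maximum, over strategies, of the probability under `P | E`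
of winning coordinate `i` of the `n`-fold GHZ game. -/
noncomputable def valCoord {n : ℕ} (E1 E2 E3 : Set (Vec n)) (i : Fin n) : ℝ :=
  ⨆ f : (Vec n → Vec n) × (Vec n → Vec n) × (Vec n → Vec n),
    (Nat.card {p : Vec n × Vec n // p ∈ condSet E1 E2 E3 ∧
        winCoord f.1 f.2.1 f.2.2 p.1 p.2 i} : ℝ) / (Nat.card (condSet E1 E2 E3) : ℝ)

open Classical in
/-- The number of queries in `E1 × E2 × E3` on which a strategy wins coordinate `i` is at most
`valCoord E1 E2 E3 i` times the number of queries in `E1 × E2 × E3`. -/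
theorem card_winCoord_le_valCoord_mul {n : ℕ} (E1 E2 E3 : Set (Vec n))
    (f1 f2 f3 : Vec n → Vec n) (i : Fin n) :
    ((Finset.univ.filter (fun p : Vec n × Vec n =>
        p ∈ condSet E1 E2 E3 ∧ winCoord f1 f2 f3 p.1 p.2 i)).card : ℝ)
      ≤ valCoord E1 E2 E3 i * (Nat.card (condSet E1 E2 E3) : ℝ) := by
  have hcard : (Finset.univ.filter (fun p : Vec n × Vec n =>
      p ∈ condSet E1 E2 E3 ∧ winCoord f1 f2 f3 p.1 p.2 i)).card
      = Nat.card {p : Vec n × Vec n // p ∈ condSet E1 E2 E3 ∧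
          winCoord f1 f2 f3 p.1 p.2 i} := by
    rw [Nat.card_eq_fintype_card, Fintype.card_subtype]
  have hsub : (Finset.univ.filter (fun p : Vec n × Vec n =>
      p ∈ condSet E1 E2 E3 ∧ winCoord f1 f2 f3 p.1 p.2 i)).card
      ≤ Nat.card (condSet E1 E2 E3) := by
    rw [Nat.card_eq_fintype_card, Fintype.card_subtype]
    exact Finset.card_le_card (Finset.monotone_filter_right _ fun p _ hp => hp.1)
  rcases (Nat.card (condSet E1 E2 E3)).eq_zero_or_pos with h0 | hpos
  · rw [h0] at hsub ⊢
    simp [Nat.le_zero.mp hsub]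
  · rw [← div_le_iff₀ (by exact_mod_cast hpos), hcard]
    exact le_ciSup (f := fun f : (Vec n → Vec n) × (Vec n → Vec n) × (Vec n → Vec n) =>
      (Nat.card {p : Vec n × Vec n // p ∈ condSet E1 E2 E3 ∧
        winCoord f.1 f.2.1 f.2.2 p.1 p.2 i} : ℝ) / (Nat.card (condSet E1 E2 E3) : ℝ))
      (Set.finite_range _).bddAbove (f1, f2, f3)

open Classical in
/-- If every product event of probability at least `r` has average coordinate value at most
`1 - c`, then every product event satisfies the same bound up to an additive error `r`. -/
theorem sum_card_winCoord_le {n : ℕ} (hn : 0 < n) {c r : ℝ} (hc1 : c ≤ 1) (hr : 0 ≤ r)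
    (h : ∀ E1 E2 E3 : Set (Vec n), r ≤ probE E1 E2 E3 →
      (1 / (n : ℝ)) * ∑ i : Fin n, valCoord E1 E2 E3 i ≤ 1 - c)
    (E1 E2 E3 : Set (Vec n)) (f1 f2 f3 : Vec n → Vec n) :
    ∑ i : Fin n, ((Finset.univ.filter (fun p : Vec n × Vec n =>
        p ∈ condSet E1 E2 E3 ∧ winCoord f1 f2 f3 p.1 p.2 i)).card : ℝ)
      ≤ n * ((1 - c) * ((Finset.univ.filter (fun p : Vec n × Vec n =>
        p ∈ condSet E1 E2 E3)).card : ℝ) + r * 2 ^ (2 * n)) := by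
  have hn' : (0 : ℝ) < n := by exact_mod_cast hn
  have hcard : Nat.card (condSet E1 E2 E3)
      = (Finset.univ.filter (fun p : Vec n × Vec n => p ∈ condSet E1 E2 E3)).card := by
    rw [Nat.card_eq_fintype_card, Fintype.card_subtype]
  by_cases hE : r ≤ probE E1 E2 E3
  · have hval := h E1 E2 E3 hE
    rw [one_div, inv_mul_le_iff₀ hn'] at hval
    calc _ ≤ ∑ i : Fin n, valCoord E1 E2 E3 i * (Nat.card (condSet E1 E2 E3) : ℝ) :=
          Finset.sum_le_sum fun i _ => card_winCoord_le_valCoord_mul E1 E2 E3 f1 f2 f3 i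
      _ = (∑ i : Fin n, valCoord E1 E2 E3 i) * (Nat.card (condSet E1 E2 E3) : ℝ) :=
          (Finset.sum_mul _ _ _).symm
      _ ≤ (n * (1 - c)) * (Nat.card (condSet E1 E2 E3) : ℝ) := by gcongr
      _ ≤ _ := by
          rw [hcard, mul_assoc]
          gcongr
          exact le_add_of_nonneg_right (by positivity)
  · rw [probE, hcard, not_le, div_lt_iff₀ (by positivity)] at hE
    calc _ ≤ ∑ _i : Fin n, r * (2 : ℝ) ^ (2 * n) := by
          refine Finset.sum_le_sum fun i _ => le_trans ?_ hE.le
          exact Nat.cast_le.mpr (Finset.card_le_card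
            (Finset.monotone_filter_right _ fun p _ hp => hp.1))
      _ = n * (r * 2 ^ (2 * n)) := by simp
      _ ≤ _ := by
          gcongr
          exact le_add_of_nonneg_left (mul_nonneg (by linarith) (by positivity))

/-- The restriction to `S` of a question `x` together with the answer `f x`. -/
def transcript {n : ℕ} (S : Finset (Fin n)) (f : Vec n → Vec n) (x : Vec n) :
    S → ZMod 2 × ZMod 2 :=
  fun i => (x i, f x i)

/-- The number of queries on which the players win all coordinates in `S`. -/
def winCount {n : ℕ} (f1 f2 f3 : Vec n → Vec n) (S : Finset (Fin n)) : ℕ :=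
  (Finset.univ.filter (fun p : Vec n × Vec n =>
    ∀ i ∈ S, winCoord f1 f2 f3 p.1 p.2 i)).card

theorem winCoord_iff_of_transcript_eq {n : ℕ} {S : Finset (Fin n)} {f1 f2 f3 : Vec n → Vec n}
    {p q : Vec n × Vec n} (h1 : transcript S f1 p.1 = transcript S f1 q.1)
    (h2 : transcript S f2 p.2 = transcript S f2 q.2)
    (h3 : transcript S f3 (p.1 + p.2) = transcript S f3 (q.1 + q.2)) {i : Fin n} (hi : i ∈ S) :
    winCoord f1 f2 f3 p.1 p.2 i ↔ winCoord f1 f2 f3 q.1 q.2 i := by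
  have e1 := Prod.mk.inj (congrFun h1 ⟨i, hi⟩)
  have e2 := Prod.mk.inj (congrFun h2 ⟨i, hi⟩)
  have e3 := Prod.mk.inj (congrFun h3 ⟨i, hi⟩)
  simp only [winCoord, e1.1, e1.2, e2.1, e2.2, e3.1, e3.2]

theorem sum_winCount_insert_le {n : ℕ} (hn : 0 < n) {c r : ℝ} (hc1 : c ≤ 1) (hr : 0 ≤ r)
    (h : ∀ E1 E2 E3 : Set (Vec n), r ≤ probE E1 E2 E3 →
      (1 / (n : ℝ)) * ∑ i : Fin n, valCoord E1 E2 E3 i ≤ 1 - c)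
    (f1 f2 f3 : Vec n → Vec n) (S : Finset (Fin n)) :
    ∑ i : Fin n, (winCount f1 f2 f3 (insert i S) : ℝ)
      ≤ n * ((1 - c) * winCount f1 f2 f3 S + 64 ^ S.card * (r * 2 ^ (2 * n))) := by
  classical
  let K := (S → ZMod 2 × ZMod 2) × (S → ZMod 2 × ZMod 2) × (S → ZMod 2 × ZMod 2)
  let key : Vec n × Vec n → K := fun p =>
    (transcript S f1 p.1, transcript S f2 p.2, transcript S f3 (p.1 + p.2))
  have hK : Fintype.card K = 64 ^ S.card := by
    simp only [K, Fintype.card_prod, Fintype.card_fun, ZMod.card, Fintype.card_coe, ← mul_pow]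
    norm_num
  have hfib (T : Finset (Fin n)) : (winCount f1 f2 f3 T : ℝ)
      = ∑ q : K, ((Finset.univ.filter (fun p : Vec n × Vec n =>
          (∀ i ∈ T, winCoord f1 f2 f3 p.1 p.2 i) ∧ key p = q)).card : ℝ) := by
    rw [winCount, Finset.card_eq_sum_card_fiberwise (f := key) (t := Finset.univ)
      (fun _ _ => Finset.mem_coe.mpr (Finset.mem_univ _))]
    simp only [Finset.filter_filter, Nat.cast_sum]
  have hbound (q : K) : ∑ i : Fin n, ((Finset.univ.filter (fun p : Vec n × Vec n =>
        (∀ j ∈ insert i S, winCoord f1 f2 f3 p.1 p.2 j) ∧ key p = q)).card : ℝ)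
      ≤ n * ((1 - c) * ((Finset.univ.filter (fun p : Vec n × Vec n =>
        (∀ j ∈ S, winCoord f1 f2 f3 p.1 p.2 j) ∧ key p = q)).card : ℝ)
          + r * 2 ^ (2 * n)) := by
    by_cases hq : ∃ p₀ : Vec n × Vec n, (∀ j ∈ S, winCoord f1 f2 f3 p₀.1 p₀.2 j) ∧ key p₀ = q
    · obtain ⟨p₀, hwin, rfl⟩ := hq
      let E1 : Set (Vec n) := {x | transcript S f1 x = transcript S f1 p₀.1}
      let E2 : Set (Vec n) := {x | transcript S f2 x = transcript S f2 p₀.2}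
      let E3 : Set (Vec n) := {x | transcript S f3 x = transcript S f3 (p₀.1 + p₀.2)}
      have hkey (p : Vec n × Vec n) : p ∈ condSet E1 E2 E3 ↔
          (∀ j ∈ S, winCoord f1 f2 f3 p.1 p.2 j) ∧ key p = key p₀ := by
        simp only [condSet, E1, E2, E3, key, Set.mem_ofPred_eq]
        refine ⟨fun ⟨h1, h2, h3⟩ => ⟨fun j hj => ?_, by rw [h1, h2, h3]⟩,
          fun hp => ⟨congrArg (·.1) hp.2, congrArg (·.2.1) hp.2, congrArg (·.2.2) hp.2⟩⟩
        exact (winCoord_iff_of_transcript_eq h1 h2 h3 hj).mpr (hwin j hj)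
      have hmain := sum_card_winCoord_le hn hc1 hr h E1 E2 E3 f1 f2 f3
      simp only [hkey] at hmain
      convert hmain using 4 with i _
      ext p
      simp only [Finset.mem_filter, Finset.forall_mem_insert]
      tauto
    · have hle : (0 : ℝ) ≤ 1 - c := by linarith
      rw [Finset.sum_eq_zero]
      · positivity
      · intro i _
        rw [Nat.cast_eq_zero, Finset.card_eq_zero, Finset.filter_eq_empty_iff]
        exact fun p _ hp => hq ⟨p, fun j hj => hp.1 j (Finset.mem_insert_of_mem hj), hp.2⟩
  calc ∑ i : Fin n, (winCount f1 f2 f3 (insert i S) : ℝ)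
      = ∑ q : K, ∑ i : Fin n, ((Finset.univ.filter (fun p : Vec n × Vec n =>
        (∀ j ∈ insert i S, winCoord f1 f2 f3 p.1 p.2 j) ∧ key p = q)).card : ℝ) := by
        rw [Finset.sum_comm]
        exact Finset.sum_congr rfl fun i _ => hfib _
    _ ≤ ∑ q : K, n * ((1 - c) * ((Finset.univ.filter (fun p : Vec n × Vec n =>
        (∀ j ∈ S, winCoord f1 f2 f3 p.1 p.2 j) ∧ key p = q)).card : ℝ)
          + r * 2 ^ (2 * n)) := Finset.sum_le_sum fun q _ => hbound q
    _ = _ := by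
        rw [← Finset.mul_sum, Finset.sum_add_distrib, ← Finset.mul_sum, ← hfib,
          Finset.sum_const, Finset.card_univ, hK, nsmul_eq_mul]
        push_cast
        rfl

theorem exists_winCount_insert_le {n : ℕ} (hn : 0 < n) {c r : ℝ} (hc1 : c ≤ 1) (hr : 0 ≤ r)
    (h : ∀ E1 E2 E3 : Set (Vec n), r ≤ probE E1 E2 E3 →
      (1 / (n : ℝ)) * ∑ i : Fin n, valCoord E1 E2 E3 i ≤ 1 - c)
    (f1 f2 f3 : Vec n → Vec n) (S : Finset (Fin n)) :
    ∃ i : Fin n, (winCount f1 f2 f3 (insert i S) : ℝ)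
      ≤ (1 - c) * winCount f1 f2 f3 S + 64 ^ S.card * (r * 2 ^ (2 * n)) := by
  have : Nonempty (Fin n) := ⟨⟨0, hn⟩⟩
  obtain ⟨i, -, hi⟩ := Finset.exists_le_of_sum_le (s := (Finset.univ : Finset (Fin n)))
    (f := fun i => (winCount f1 f2 f3 (insert i S) : ℝ))
    (g := fun _ => (1 - c) * winCount f1 f2 f3 S + 64 ^ S.card * (r * 2 ^ (2 * n)))
    Finset.univ_nonempty
    (by
      rw [Finset.sum_const, Finset.card_univ, Fintype.card_fin, nsmul_eq_mul]
      exact sum_winCount_insert_le hn hc1 hr h f1 f2 f3 S)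
  exact ⟨i, hi⟩

theorem card_vec_prod (n : ℕ) : Fintype.card (Vec n × Vec n) = 2 ^ (2 * n) := by
  simp [two_mul, pow_add]

theorem exists_winCount_le {n : ℕ} (hn : 0 < n) {c r : ℝ} (hc0 : 0 ≤ c) (hc1 : c ≤ 1)
    (hr : 0 ≤ r)
    (h : ∀ E1 E2 E3 : Set (Vec n), r ≤ probE E1 E2 E3 →
      (1 / (n : ℝ)) * ∑ i : Fin n, valCoord E1 E2 E3 i ≤ 1 - c)
    (f1 f2 f3 : Vec n → Vec n) (k : ℕ) :
    ∃ S : Finset (Fin n), S.card ≤ k ∧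
      (winCount f1 f2 f3 S : ℝ) ≤ ((1 - c) ^ k + 64 ^ k * r) * 2 ^ (2 * n) := by
  induction k with
  | zero =>
    refine ⟨∅, le_rfl, ?_⟩
    have hle : (winCount f1 f2 f3 ∅ : ℝ) ≤ 2 ^ (2 * n) := by
      exact_mod_cast (Finset.card_le_univ _).trans_eq (card_vec_prod n)
    refine hle.trans (le_mul_of_one_le_left (by positivity) ?_)
    simpa using hr
  | succ k ih =>
    obtain ⟨S, hS, hwin⟩ := ih
    obtain ⟨i, hi⟩ := exists_winCount_insert_le hn hc1 hr h f1 f2 f3 S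
    refine ⟨insert i S, (Finset.card_insert_le _ _).trans (by omega), hi.trans ?_⟩
    have hc : 0 ≤ 1 - c := by linarith
    have hpow : (64 : ℝ) ^ S.card ≤ 64 ^ k := pow_le_pow_right₀ (by norm_num) hS
    set D : ℝ := 2 ^ (2 * n)
    have hD : 0 ≤ D := by positivity
    have hkr : 0 ≤ 64 ^ k * (r * D) := by positivity
    calc (1 - c) * (winCount f1 f2 f3 S : ℝ) + 64 ^ S.card * (r * D)
        ≤ (1 - c) * (((1 - c) ^ k + 64 ^ k * r) * D) + 64 ^ k * (r * D) := by gcongr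
      _ = (1 - c) ^ (k + 1) * D + (2 - c) * (64 ^ k * (r * D)) := by ring
      _ ≤ (1 - c) ^ (k + 1) * D + 64 * (64 ^ k * (r * D)) := by gcongr; linarith
      _ = _ := by ring

theorem winCount_univ_le {n : ℕ} (f1 f2 f3 : Vec n → Vec n) (S : Finset (Fin n)) :
    winCount f1 f2 f3 Finset.univ ≤ winCount f1 f2 f3 S :=
  Finset.card_le_card
    (Finset.monotone_filter_right _ fun _ _ hp i _ => hp i (Finset.mem_univ i))

/-- If the criterion holds at level `r ≤ 1`, the whole event shows that the fraction of won
queries is at most `1 - c`. -/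
theorem winCount_univ_le_one_sub {n : ℕ} (hn : 0 < n) {c r : ℝ} (hr1 : r ≤ 1)
    (h : ∀ E1 E2 E3 : Set (Vec n), r ≤ probE E1 E2 E3 →
      (1 / (n : ℝ)) * ∑ i : Fin n, valCoord E1 E2 E3 i ≤ 1 - c)
    (f1 f2 f3 : Vec n → Vec n) :
    (winCount f1 f2 f3 Finset.univ : ℝ) ≤ (1 - c) * 2 ^ (2 * n) := by
  have hn' : (0 : ℝ) < n := by exact_mod_cast hn
  have hcard : Nat.card (condSet (Set.univ : Set (Vec n)) Set.univ Set.univ) = 2 ^ (2 * n) := by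
    rw [← card_vec_prod, ← Nat.card_eq_fintype_card]
    simp [condSet]
  have hprob : probE (Set.univ : Set (Vec n)) Set.univ Set.univ = 1 := by
    rw [probE, hcard]
    push_cast
    exact div_self (by positivity)
  have hval := h Set.univ Set.univ Set.univ (hprob ▸ hr1)
  rw [one_div, inv_mul_le_iff₀ hn'] at hval
  have hle (i : Fin n) : (winCount f1 f2 f3 Finset.univ : ℝ)
      ≤ valCoord (Set.univ : Set (Vec n)) Set.univ Set.univ i * 2 ^ (2 * n) := by
    have hi := card_winCoord_le_valCoord_mul Set.univ Set.univ Set.univ f1 f2 f3 i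
    rw [hcard] at hi
    push_cast at hi
    refine le_trans ?_ hi
    exact_mod_cast Finset.card_le_card fun p hp => by
      simp only [Finset.mem_filter, Finset.mem_univ, true_and, true_implies] at hp ⊢
      exact ⟨by simp [condSet], hp i⟩
  have hsum := Finset.sum_le_sum fun i (_ : i ∈ (Finset.univ : Finset (Fin n))) => hle i
  rw [← Finset.sum_mul, Finset.sum_const, Finset.card_univ, Fintype.card_fin,
    nsmul_eq_mul] at hsum
  refine le_of_mul_le_mul_left (hsum.trans ?_) hn'
  rw [← mul_assoc]
  gcongr

theorem exists_pow_add_pow_mul_le_rpow {c r : ℝ} (hc0 : 0 < c) (hc1 : c ≤ 1) (hr : 0 < r)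
    (hlog : Real.log r ≤ -(40 / c)) :
    ∃ k : ℕ, (1 - c) ^ k + 64 ^ k * r ≤ r ^ (c ^ 2 / 40) := by
  set L : ℝ := -Real.log r with hL
  have hrL : r = Real.exp (-L) := by rw [hL, neg_neg, Real.exp_log hr]
  have hcL : 40 ≤ c * L := by
    have : 40 / c ≤ L := by linarith
    rw [div_le_iff₀ hc0] at this
    linarith
  have hL0 : 0 < L := by nlinarith
  refine ⟨⌊L / 10⌋₊, ?_⟩
  set k : ℕ := ⌊L / 10⌋₊
  have hk1 : (k : ℝ) ≤ L / 10 := Nat.floor_le (by positivity)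
  have hk2 : L / 10 < k + 1 := Nat.lt_floor_add_one _
  have h64 : (64 : ℝ) ≤ Real.exp 5 := by
    have h2 : (2.7 : ℝ) ≤ Real.exp 1 := by linarith [Real.exp_one_gt_d9]
    calc (64 : ℝ) ≤ 2.7 ^ 5 := by norm_num
      _ ≤ Real.exp 1 ^ 5 := by gcongr
      _ = Real.exp 5 := by rw [← Real.exp_nat_mul]; norm_num
  have hfirst : (1 - c) ^ k ≤ Real.exp (1 - c * L / 10) := by
    calc (1 - c) ^ k ≤ Real.exp (-c) ^ k :=
          pow_le_pow_left₀ (by linarith) (Real.one_sub_le_exp_neg c) k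
      _ = Real.exp (k * -c) := (Real.exp_nat_mul _ _).symm
      _ ≤ _ := Real.exp_le_exp.mpr (by nlinarith)
  have hsecond : 64 ^ k * r ≤ Real.exp (1 - c * L / 10) := by
    calc 64 ^ k * r ≤ Real.exp 5 ^ k * Real.exp (-L) := by rw [← hrL]; gcongr
      _ = Real.exp (k * 5 - L) := by rw [← Real.exp_nat_mul, ← Real.exp_add, sub_eq_add_neg]
      _ ≤ _ := Real.exp_le_exp.mpr (by nlinarith)
  have hexp : 1 + (1 - c * L / 10) ≤ -L * (c ^ 2 / 40) := by nlinarith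
  calc (1 - c) ^ k + 64 ^ k * r ≤ 2 * Real.exp (1 - c * L / 10) := by linarith
    _ ≤ Real.exp 1 * Real.exp (1 - c * L / 10) := by
        gcongr
        linarith [Real.exp_one_gt_d9]
    _ = Real.exp (1 + (1 - c * L / 10)) := (Real.exp_add _ _).symm
    _ ≤ Real.exp (-L * (c ^ 2 / 40)) := Real.exp_le_exp.mpr hexp
    _ = r ^ (c ^ 2 / 40) := by rw [Real.rpow_def_of_pos hr, hL, neg_neg]

/-- Parallel Repetition Criterion: if conditioning on any not-too-small product event keeps
the average coordinate value bounded away from `1`, then the value of the `n`-fold GHZ game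
is at most `ρ(n) ^ c'` for some constant `c' > 0`. -/
theorem ghz_parallel_repetition_criterion
    (c : ℝ) (hc0 : 0 < c) (hc1 : c ≤ 1) (ρ : ℕ → ℝ)
    (hρ : ∀ n : ℕ, Real.exp (-(n : ℝ)) ≤ ρ n ∧ ρ n ≤ 1)
    (hcrit : ∃ N0 : ℕ, ∀ n : ℕ, N0 ≤ n → ∀ E1 E2 E3 : Set (Vec n),
      ρ n ≤ probE E1 E2 E3 →
      (1 / (n : ℝ)) * ∑ i : Fin n, valCoord E1 E2 E3 i ≤ 1 - c) :
    ∃ c' : ℝ, 0 < c' ∧ ∃ N : ℕ, ∀ n : ℕ, N ≤ n →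
      ∀ f1 f2 f3 : Vec n → Vec n,
        ((Finset.univ.filter (fun p : Vec n × Vec n =>
            ∀ i : Fin n, winCoord f1 f2 f3 p.1 p.2 i)).card : ℝ) / (2 : ℝ) ^ (2 * n)
          ≤ (ρ n) ^ c' := by
  obtain ⟨N0, hN0⟩ := hcrit
  refine ⟨c ^ 2 / 40, by positivity, max N0 1, fun n hn f1 f2 f3 => ?_⟩
  have hn0 : 0 < n := (le_max_right N0 1).trans hn
  have h := hN0 n ((le_max_left N0 1).trans hn)
  have hr : 0 < ρ n := (Real.exp_pos _).trans_le (hρ n).1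
  have hcount : (Finset.univ.filter (fun p : Vec n × Vec n =>
      ∀ i : Fin n, winCoord f1 f2 f3 p.1 p.2 i)).card = winCount f1 f2 f3 Finset.univ := by
    simp [winCount]
  rw [hcount, div_le_iff₀ (by positivity)]
  by_cases hlog : Real.log (ρ n) ≤ -(40 / c)
  · obtain ⟨k, hk⟩ := exists_pow_add_pow_mul_le_rpow hc0 hc1 hr hlog
    obtain ⟨S, -, hS⟩ := exists_winCount_le hn0 hc0.le hc1 hr.le h f1 f2 f3 k
    calc (winCount f1 f2 f3 Finset.univ : ℝ) ≤ winCount f1 f2 f3 S := by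
          exact_mod_cast winCount_univ_le f1 f2 f3 S
      _ ≤ ((1 - c) ^ k + 64 ^ k * ρ n) * 2 ^ (2 * n) := hS
      _ ≤ _ := by gcongr
  · refine (winCount_univ_le_one_sub hn0 (hρ n).2 h f1 f2 f3).trans ?_
    gcongr
    refine (Real.one_sub_le_exp_neg c).trans ?_
    rw [Real.rpow_def_of_pos hr]
    refine Real.exp_le_exp.mpr ?_
    calc -c = -(40 / c) * (c ^ 2 / 40) := by field_simp
      _ ≤ Real.log (ρ n) * (c ^ 2 / 40) := by
          gcongr
          exact (not_le.mp hlog).le
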